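/- arXiv:2107.06526 — 3 statements merged into one kernel-verified Lean document; each statement's English description precedes it below -/
import Mathlib

section
/- Let U ⊆ ℝⁿ be open and let f : U → ℝ be positive homogeneous of degree m (i.e. f(λx) = λ^m f(x) for all x ∈ U and λ > 0 with λx ∈ U) and have continuous partial derivatives up to order m on U (i.e. f is C^m on U). Let a, b ∈ U be such that the line segment connecting a and b lies in U. Then the m-th order Taylor polynomial of f at a evaluated at increment b − a satisfies T^(m) f(a; b−a) = f(a) + Σ_{k=1}^m (1/k!) d^k f(a; b−a) = (1/m!) d^m f(a; b), where d^k f(a; t) denotes the k-th derivative of f at a applied to the k-tuple (t, …, t), i.e. d^k f(a;t) = Σ_{indices} D_{k₁…k_k} f(a) t_{k₁} ⋯ t_{k_k}. -/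
section IteratedFDerivSymmetric

variable {E F : Type*} [NormedAddCommGroup E] [NormedSpace ℝ E]
  [NormedAddCommGroup F] [NormedSpace ℝ F]

/-- The first two arguments of a higher derivative commute. -/
theorem ContDiffAt.iteratedFDeriv_cons_cons_swap {f : E → F} {x : E} {n : ℕ}
    (hf : ContDiffAt ℝ (n + 2 : ℕ) f x) (u v : E) (w : Fin n → E) :
    iteratedFDeriv ℝ (n + 2) f x (Fin.cons u (Fin.cons v w)) =
      iteratedFDeriv ℝ (n + 2) f x (Fin.cons v (Fin.cons u w)) := by
  have hg : ContDiffAt ℝ 2 (iteratedFDeriv ℝ n f) x :=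
    hf.iteratedFDeriv_right (by push_cast; rw [add_comm])
  have hsymm : IsSymmSndFDerivAt ℝ (iteratedFDeriv ℝ n f) x :=
    hg.isSymmSndFDerivAt (by simp)
  have hdiff : DifferentiableAt ℝ (iteratedFDeriv ℝ (n + 1) f) x :=
    hf.differentiableAt_iteratedFDeriv (by exact_mod_cast Nat.lt_succ_self (n + 1))
  have hdiff' : DifferentiableAt ℝ (fderiv ℝ (iteratedFDeriv ℝ n f)) x :=
    (hg.fderiv_right (m := 1) (by norm_num)).differentiableAt (by norm_num)
  have key : ∀ u v : E, iteratedFDeriv ℝ (n + 2) f x (Fin.cons u (Fin.cons v w)) =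
      fderiv ℝ (fderiv ℝ (iteratedFDeriv ℝ n f)) x u v w := by
    intro u v
    rw [hdiff.iteratedFDeriv_succ_apply_left']
    simp only [Fin.tail_cons, Fin.cons_zero, iteratedFDeriv_succ_apply_left]
    have h := (hdiff'.hasFDerivAt.clm_apply (hasFDerivAt_const v x))
    rw [fderiv_continuousMultilinear_apply_const h.differentiableAt, h.fderiv]
    simp
  rw [key, key, hsymm.eq]

/-- The `n`-th derivative of a `C^n` function on a real normed space is invariant under
transposing two consecutive arguments. -/
theorem ContDiffAt.iteratedFDeriv_comp_swap_castSucc_succ {f : E → F} {n : ℕ} :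
    ∀ {x : E}, ContDiffAt ℝ (n + 1 : ℕ) f x → ∀ (i : Fin n) (v : Fin (n + 1) → E),
    iteratedFDeriv ℝ (n + 1) f x (v ∘ Equiv.swap i.castSucc i.succ) =
      iteratedFDeriv ℝ (n + 1) f x v := by
  induction n with
  | zero => exact fun _ i => i.elim0
  | succ n ih =>
    intro x hf i v
    induction i using Fin.cases with
    | zero =>
      have h₁ : v = Fin.cons (v 0) (Fin.cons (v 1) (Fin.tail (Fin.tail v))) := by
        ext j
        refine Fin.cases rfl (fun j => Fin.cases rfl (fun j => rfl) j) j
      have h₂ : v ∘ Equiv.swap (Fin.castSucc 0) (Fin.succ 0) =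
          Fin.cons (v 1) (Fin.cons (v 0) (Fin.tail (Fin.tail v))) := by
        ext j
        refine Fin.cases (by simp) (fun j => Fin.cases (by simp) (fun j => ?_) j) j
        have : Equiv.swap (0 : Fin (n + 2)) 1 j.succ.succ = j.succ.succ :=
          Equiv.swap_apply_of_ne_of_ne (Fin.succ_ne_zero _) (by simp [Fin.ext_iff])
        simp [this, Fin.tail]
      rw [h₂, hf.iteratedFDeriv_cons_cons_swap, ← h₁]
    | succ i =>
      have hdiff : DifferentiableAt ℝ (iteratedFDeriv ℝ (n + 1) f) x :=
        hf.differentiableAt_iteratedFDeriv (by exact_mod_cast Nat.lt_succ_self (n + 1))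
      rw [hdiff.iteratedFDeriv_succ_apply_left', hdiff.iteratedFDeriv_succ_apply_left']
      have h₀ : (v ∘ Equiv.swap i.succ.castSucc i.succ.succ) 0 = v 0 := by
        rw [Function.comp_apply, Equiv.swap_apply_of_ne_of_ne] <;>
          simp [Fin.ext_iff]
      have ht : Fin.tail (v ∘ Equiv.swap i.succ.castSucc i.succ.succ) =
          Fin.tail v ∘ Equiv.swap i.castSucc i.succ := by
        ext j
        simp only [Fin.tail, Function.comp_apply, Fin.castSucc_succ]
        rw [(Fin.succ_injective _).swap_apply]
      rw [h₀, ht]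
      congr 1
      apply Filter.EventuallyEq.fderiv_eq
      have hf' : ContDiffAt ℝ (n + 1 : ℕ) f x := hf.of_le (by exact_mod_cast Nat.le_succ _)
      filter_upwards [hf'.eventually (by simp)] with y hy
      exact ih hy i (Fin.tail v)

/-- The `n`-th derivative of a `C^n` function on a real normed space is symmetric. -/
theorem ContDiffAt.iteratedFDeriv_comp_perm_of_real {f : E → F} {x : E} {n : ℕ}
    (hf : ContDiffAt ℝ n f x) (v : Fin n → E) (σ : Equiv.Perm (Fin n)) :
    iteratedFDeriv ℝ n f x (v ∘ σ) = iteratedFDeriv ℝ n f x v := by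
  cases n with
  | zero => congr 1; ext i; exact i.elim0
  | succ n =>
    have hσ : σ ∈ Submonoid.closure
        (Set.range fun i : Fin n ↦ Equiv.swap i.castSucc i.succ) := by
      rw [Equiv.Perm.mclosure_swap_castSucc_succ]; trivial
    induction hσ using Submonoid.closure_induction generalizing v with
    | mem σ hσ =>
      obtain ⟨i, rfl⟩ := hσ
      exact hf.iteratedFDeriv_comp_swap_castSucc_succ i v
    | one => rfl
    | mul σ τ _ _ hσ hτ =>
      rw [Equiv.Perm.coe_mul, ← Function.comp_assoc, hτ, hσ]

end IteratedFDerivSymmetric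

section PosHomogeneous

variable {E F : Type*} [NormedAddCommGroup E] [NormedSpace ℝ E]
  [NormedAddCommGroup F] [NormedSpace ℝ F]

/-- The derivatives of a positively homogeneous function are themselves homogeneous. -/
theorem iteratedFDeriv_smul_of_posHomogeneousOn {f : E → F} {U : Set E} {m : ℕ}
    (hU : IsOpen U)
    (hhom : ∀ x ∈ U, ∀ l : ℝ, 0 < l → l • x ∈ U → f (l • x) = l ^ m • f x)
    {x : E} (hx : x ∈ U) {l : ℝ} (hl : 0 < l) (hlx : l • x ∈ U)
    {k : ℕ} (hf : ContDiffAt ℝ k f x) (w : Fin k → E) :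
    l ^ k • iteratedFDeriv ℝ k f (l • x) w = l ^ m • iteratedFDeriv ℝ k f x w := by
  let g : E ≃L[ℝ] E := ContinuousLinearEquiv.smulLeft (Units.mk0 l hl.ne')
  have hg : ∀ y, g y = l • y := fun _ => rfl
  have hcomp := g.iteratedFDerivWithin_comp_right f uniqueDiffOn_univ (x := x) (Set.mem_univ _) k
  simp only [Set.preimage_univ, iteratedFDerivWithin_univ] at hcomp
  have hev : f ∘ g =ᶠ[nhds x] l ^ m • f := by
    filter_upwards [hU.mem_nhds hx,
      g.continuous.continuousAt.preimage_mem_nhds (hU.mem_nhds hlx)] with y hy hly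
    exact hhom y hy l hl hly
  rw [(hev.iteratedFDeriv ℝ k).eq_of_nhds, iteratedFDeriv_const_smul_apply hf] at hcomp
  have := congrArg (fun T => T w) hcomp
  simp only [ContinuousMultilinearMap.compContinuousLinearMap_apply,
    smul_apply] at this
  rw [this]
  simpa [hg] using
    ((iteratedFDeriv ℝ k f (l • x)).map_smul_univ (fun _ => l) w).symm

/-- Euler's identity for the derivatives of a positively homogeneous function. -/
theorem iteratedFDeriv_succ_cons_self_of_posHomogeneousOn {f : E → F} {U : Set E} {m : ℕ}
    (hU : IsOpen U)
    (hhom : ∀ x ∈ U, ∀ l : ℝ, 0 < l → l • x ∈ U → f (l • x) = l ^ m • f x)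
    {x : E} (hx : x ∈ U) {k : ℕ} (hf : ContDiffAt ℝ (k + 1 : ℕ) f x) (w : Fin k → E) :
    iteratedFDeriv ℝ (k + 1) f x (Fin.cons x w) =
      ((m : ℝ) - k) • iteratedFDeriv ℝ k f x w := by
  have hdiff : DifferentiableAt ℝ (iteratedFDeriv ℝ k f) x :=
    hf.differentiableAt_iteratedFDeriv (by exact_mod_cast Nat.lt_succ_self k)
  have hray : HasDerivAt (fun l : ℝ => l • x) x 1 := by
    simpa using (hasDerivAt_id (1 : ℝ)).smul_const x
  have hD : HasDerivAt (fun l : ℝ => iteratedFDeriv ℝ k f (l • x) w)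
      (iteratedFDeriv ℝ (k + 1) f x (Fin.cons x w)) 1 := by
    have hd : HasFDerivAt (iteratedFDeriv ℝ k f) (fderiv ℝ (iteratedFDeriv ℝ k f) x)
        ((1 : ℝ) • x) := by simpa using hdiff.hasFDerivAt
    exact ((ContinuousMultilinearMap.apply ℝ (fun _ : Fin k => E) F w).hasFDerivAt.comp_hasDerivAt
      1 (hd.comp_hasDerivAt 1 hray) :)
  have hL := (hasDerivAt_pow k (1 : ℝ)).smul hD
  have hR := (hasDerivAt_pow m (1 : ℝ)).smul_const (iteratedFDeriv ℝ k f x w)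
  have hev : (fun l : ℝ => l ^ m • iteratedFDeriv ℝ k f x w) =ᶠ[nhds 1]
      fun l : ℝ => l ^ k • iteratedFDeriv ℝ k f (l • x) w := by
    have hxU : ∀ᶠ l : ℝ in nhds 1, l • x ∈ U :=
      hray.continuousAt.preimage_mem_nhds (hU.mem_nhds (by simpa using hx))
    filter_upwards [hxU, lt_mem_nhds (zero_lt_one' ℝ)] with l hlx hl
    exact (iteratedFDeriv_smul_of_posHomogeneousOn hU hhom hx hl hlx
      (hf.of_le (by exact_mod_cast Nat.le_succ k)) w).symm
  have := hL.unique (hR.congr_of_eventuallyEq hev.symm)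
  simp only [one_pow, one_smul, mul_one] at this
  rw [sub_smul, ← this]
  abel

end PosHomogeneous

/-- A triangular array satisfying a Pascal-type recursion is a binomial combination of its
zeroth column. -/
theorem eq_sum_antidiagonal_choose_of_pascal {m : ℕ} {R : ℕ → ℕ → ℝ}
    (hR : ∀ n k, k ≤ n → n < m → R (n + 1) (k + 1) = R n k + R (n + 1) k) (k : ℕ) :
    ∀ n, n + k ≤ m →
      R (n + k) k = ∑ ij ∈ Finset.HasAntidiagonal.antidiagonal k,
        (k.choose ij.1 : ℝ) * R (n + ij.1) 0 := by
  induction k with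
  | zero => intro n _; simp
  | succ k ih =>
    intro n hn
    rw [← add_assoc, hR _ _ (by omega) (by omega), ih n (by omega),
      show n + k + 1 = n + 1 + k by omega, ih (n + 1) (by omega),
      Finset.sum_antidiagonal_choose_succ_mul (fun i _ => R (n + i) 0)]
    congr 1
    refine Finset.sum_congr rfl fun ij hij => ?_
    rw [Nat.choose_symm_of_eq_add (Finset.HasAntidiagonal.mem_antidiagonal.1 hij).symm,
      add_right_comm, add_assoc]

/-- The binomial expansion of `dᵐf(a; a + h)` for `f` positively homogeneous of degree `m`. -/
theorem iteratedFDeriv_add_of_posHomogeneousOn {E : Type*} [NormedAddCommGroup E]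
    [NormedSpace ℝ E] {f : E → ℝ} {U : Set E} {m : ℕ} (hU : IsOpen U)
    (hhom : ∀ x ∈ U, ∀ l : ℝ, 0 < l → l • x ∈ U → f (l • x) = l ^ m * f x)
    {a : E} (ha : a ∈ U) (hf : ContDiffAt ℝ m f a) (h : E) :
    iteratedFDeriv ℝ m f a (fun _ => a + h) =
      ∑ ij ∈ Finset.HasAntidiagonal.antidiagonal m, (m.choose ij.1 : ℝ) *
        ((m - ij.1).factorial * iteratedFDeriv ℝ ij.1 f a (fun _ => h)) := by
  let R : ℕ → ℕ → ℝ := fun n k => (m - n).factorial *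
    iteratedFDeriv ℝ n f a (fun i => if (i : ℕ) < k then a + h else h)
  have hR : ∀ n k, k ≤ n → n < m → R (n + 1) (k + 1) = R n k + R (n + 1) k := by
    intro n k hkn hnm
    have hfn : ContDiffAt ℝ (n + 1 : ℕ) f a := hf.of_le (by exact_mod_cast hnm)
    set w : Fin n → E := fun i => if (i : ℕ) < k then a + h else h with hw
    have hcons : (fun i : Fin (n + 1) => if (i : ℕ) < k + 1 then a + h else h) =
        Fin.cons (a + h) w := by
      ext i
      refine Fin.cases (by simp) (fun i => by simp [hw]) i
    have hswap : (fun i : Fin (n + 1) => if (i : ℕ) < k then a + h else h) ∘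
        Equiv.swap 0 ⟨k, Nat.lt_succ_of_le hkn⟩ = Fin.cons h w := by
      funext i
      refine Fin.cases (by simp) (fun i => ?_) i
      rw [Function.comp_apply, Equiv.swap_apply_def]
      simp only [hw, Fin.cons_succ, Fin.ext_iff, Fin.val_succ, Fin.val_zero]
      split_ifs <;> simp_all <;> omega
    have hadd : iteratedFDeriv ℝ (n + 1) f a (Fin.cons (a + h) w) =
        iteratedFDeriv ℝ (n + 1) f a (Fin.cons a w) +
          iteratedFDeriv ℝ (n + 1) f a (Fin.cons h w) :=
      (iteratedFDeriv ℝ (n + 1) f a).cons_add w a h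
    have hfac : ((m - n).factorial : ℝ) = ((m : ℝ) - n) * (m - (n + 1)).factorial := by
      rw [show m - n = m - (n + 1) + 1 by omega, Nat.factorial_succ,
        show m - (n + 1) + 1 = m - n by omega]
      push_cast [Nat.cast_sub hnm.le]
      rfl
    simp only [R]
    rw [hcons, hadd, iteratedFDeriv_succ_cons_self_of_posHomogeneousOn hU hhom ha hfn, ← hswap,
      hfn.iteratedFDeriv_comp_perm_of_real, hfac, smul_eq_mul]
    ring
  simpa [R] using eq_sum_antidiagonal_choose_of_pascal hR m 0 (by omega)


/-- Taylor expansion of a positively homogeneous function of degree `m`: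
if `f` is positively homogeneous of degree `m` and `C^m` on an open set `U ⊆ ℝⁿ`,
and the segment from `a` to `b` lies in `U`, then the `m`-th order Taylor
polynomial of `f` at `a` with increment `b - a` equals `(1/m!) dᵐf(a; b)`. -/
theorem taylor_of_posHomogeneous
    (n m : ℕ) (U : Set (EuclideanSpace ℝ (Fin n)))
    (hU : IsOpen U)
    (f : EuclideanSpace ℝ (Fin n) → ℝ)
    (hhom : ∀ x ∈ U, ∀ l : ℝ, 0 < l → l • x ∈ U → f (l • x) = l ^ m * f x)
    (hf : ContDiffOn ℝ m f U)
    (a b : EuclideanSpace ℝ (Fin n)) (ha : a ∈ U) (hb : b ∈ U)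
    (hseg : segment ℝ a b ⊆ U) :
    f a + ∑ k ∈ Finset.Icc 1 m,
        ((k.factorial : ℝ))⁻¹ * iteratedFDerivWithin ℝ k f U a (fun _ => b - a)
      = ((m.factorial : ℝ))⁻¹ * iteratedFDerivWithin ℝ m f U a (fun _ => b) := by
  have hfa : ContDiffAt ℝ m f a := hf.contDiffAt (hU.mem_nhds ha)
  have hexp := iteratedFDeriv_add_of_posHomogeneousOn hU hhom ha hfa (b - a)
  rw [add_sub_cancel] at hexp
  simp only [iteratedFDerivWithin_of_isOpen _ hU ha]
  rw [hexp, Finset.Nat.sum_antidiagonal_eq_sum_range_succ_mk, Finset.mul_sum,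
    Finset.range_eq_Ico, Finset.sum_eq_sum_Ico_succ_bot (Nat.succ_pos m)]
  congr 1
  · simp [Nat.factorial_ne_zero]
  · refine Finset.sum_congr rfl fun k hk => ?_
    rw [Nat.cast_choose ℝ (Finset.mem_Icc.1 hk).2]
    field_simp
end

section
/- Let U ⊆ ℝⁿ be open and let f : U → ℝ be positive homogeneous of degree 1 (i.e. f(λx) = λ f(x) for all x ∈ U and λ > 0 with λx ∈ U) and have continuous partial derivatives up to order ℓ on U (i.e. f is C^ℓ on U). Let a, b ∈ U be such that the line segment connecting a and b lies in U. Then for every integer m with 1 ≤ m ≤ ℓ, the m-th order Taylor polynomial of the m-th power f^m at a evaluated at increment b − a satisfies T^(m) f^m(a; b−a) = (1/m!) d^m f^m(a; b). -/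
open Filter Topology Asymptotics

/-- A polynomial of degree at most `m` which is `o(u ^ m)` at `0` vanishes. -/
theorem Polynomial.eq_zero_of_isLittleO_pow {p : Polynomial ℝ} {m : ℕ} (hdeg : p.natDegree ≤ m)
    (hp : (fun u : ℝ => p.eval u) =o[𝓝[≠] 0] fun u => u ^ m) : p = 0 := by
  induction m generalizing p with
  | zero =>
    rw [Polynomial.eq_C_of_natDegree_le_zero hdeg] at hp ⊢
    simpa using hp
  | succ m ih =>
    have hzero : p.coeff 0 = 0 := by
      have hpow : Tendsto (fun u : ℝ => u ^ (m + 1)) (𝓝[≠] 0) (𝓝 0) :=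
        ((continuous_pow (m + 1)).tendsto' 0 0 (by simp)).mono_left nhdsWithin_le_nhds
      have heval : Tendsto (fun u : ℝ => p.eval u) (𝓝[≠] 0) (𝓝 (p.eval 0)) :=
        p.continuous.continuousAt.mono_left nhdsWithin_le_nhds
      rw [Polynomial.coeff_zero_eq_eval_zero]
      exact tendsto_nhds_unique heval (hp.trans_tendsto hpow)
    have hX : p = p.divX * Polynomial.X := by
      conv_lhs => rw [← p.divX_mul_X_add, hzero]
      simp
    have hdiv : p.divX = 0 := by
      apply ih
      · rw [Polynomial.natDegree_divX_eq_natDegree_tsub_one]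
        omega
      · have hinv := (isBigO_refl (fun u : ℝ => u⁻¹) (𝓝[≠] 0)).mul_isLittleO hp
        refine hinv.congr' ?_ ?_ <;> filter_upwards [self_mem_nhdsWithin] with u hu
        · have hu : u ≠ 0 := hu
          conv_lhs => rw [hX]
          simp only [Polynomial.eval_mul, Polynomial.eval_X]
          field_simp
        · have hu : u ≠ 0 := hu
          rw [pow_succ']
          field_simp
    rw [hX, hdiv, zero_mul]

section Line

variable {E : Type*} [NormedAddCommGroup E] [NormedSpace ℝ E] {U : Set E} {g : E → ℝ} {m : ℕ}

theorem eventually_add_smul_mem (hU : IsOpen U) {a v : E} {t : ℝ} (ht : a + t • v ∈ U) :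
    ∀ᶠ s in 𝓝 t, a + s • v ∈ U :=
  (by fun_prop : Continuous fun s : ℝ => a + s • v).continuousAt.eventually (hU.mem_nhds ht)

/-- The iterated derivatives of `t ↦ g (a + t • v)` are those of `g` applied to copies of `v`. -/
theorem ContDiffOn.iteratedDeriv_add_smul (hU : IsOpen U) (hg : ContDiffOn ℝ m g U) (a v : E)
    {k : ℕ} (hk : k ≤ m) {t : ℝ} (ht : a + t • v ∈ U) :
    iteratedDeriv k (fun s : ℝ => g (a + s • v)) t
      = iteratedFDeriv ℝ k g (a + t • v) (fun _ => v) := by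
  induction k generalizing t with
  | zero => simp
  | succ k ih =>
    have hev : iteratedDeriv k (fun s : ℝ => g (a + s • v))
        =ᶠ[𝓝 t] fun s => iteratedFDeriv ℝ k g (a + s • v) (fun _ => v) :=
      (eventually_add_smul_mem hU ht).mono fun s hs => ih (by omega) hs
    rw [iteratedDeriv_succ, hev.deriv_eq]
    exact ContDiffAt.deriv_fderiv_add_smul
      ((hg.contDiffAt (hU.mem_nhds ht)).of_le (by exact_mod_cast hk))

/-- Taylor's theorem with Peano remainder along a line. -/
theorem ContDiffOn.taylor_add_smul_isLittleO (hU : IsOpen U) (hg : ContDiffOn ℝ m g U) {a : E}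
    (ha : a ∈ U) (v : E) :
    (fun t : ℝ => g (a + t • v) - ∑ k ∈ Finset.range (m + 1),
        ((k.factorial : ℝ)⁻¹ * iteratedFDeriv ℝ k g a (fun _ => v)) * t ^ k)
      =o[𝓝 0] fun t => t ^ m := by
  have ha0 : a + (0 : ℝ) • v ∈ U := by simpa using ha
  obtain ⟨r, hr, hball⟩ := Metric.eventually_nhds_iff_ball.1 (eventually_add_smul_mem hU ha0)
  have h0 : (0 : ℝ) ∈ Metric.ball (0 : ℝ) r := Metric.mem_ball_self hr
  have hline : ContDiffOn ℝ m (fun t : ℝ => g (a + t • v)) (Metric.ball 0 r) :=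
    hg.comp (by fun_prop) hball
  have htaylor := taylor_isLittleO (convex_ball 0 r) h0 hline
  rw [Metric.isOpen_ball.nhdsWithin_eq h0] at htaylor
  refine htaylor.congr (fun t => ?_) (fun t => by simp)
  rw [taylor_within_apply]
  congr 1
  refine Finset.sum_congr rfl fun k hk => ?_
  rw [iteratedDerivWithin_of_isOpen Metric.isOpen_ball h0,
    hg.iteratedDeriv_add_smul hU a v (by simpa [Nat.lt_succ_iff] using hk) ha0]
  simp
  ring

/-- For `g` homogeneous of degree `m`, the Taylor polynomial of order `m` at `a` with increment `h`
is the top-order term in the direction `a + h`. -/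
theorem ContDiffOn.sum_iteratedFDeriv_of_posHomogeneous (hU : IsOpen U) (hg : ContDiffOn ℝ m g U)
    (hhom : ∀ x ∈ U, ∀ l : ℝ, 0 < l → l • x ∈ U → g (l • x) = l ^ m * g x) {a : E}
    (ha : a ∈ U) (h : E) :
    ∑ k ∈ Finset.range (m + 1), (k.factorial : ℝ)⁻¹ * iteratedFDeriv ℝ k g a (fun _ => h)
      = (m.factorial : ℝ)⁻¹ * iteratedFDeriv ℝ m g a (fun _ => a + h) := by
  set c : ℕ → ℝ := fun k => (k.factorial : ℝ)⁻¹ * iteratedFDeriv ℝ k g a (fun _ => h) with hc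
  set d : ℕ → ℝ := fun k => (k.factorial : ℝ)⁻¹ * iteratedFDeriv ℝ k g a (fun _ => a + h) with hd
  let p : Polynomial ℝ := ∑ k ∈ Finset.range (m + 1),
    Polynomial.C (c k) * (Polynomial.X ^ k * (1 + Polynomial.X) ^ (m - k))
  let q : Polynomial ℝ := ∑ k ∈ Finset.range (m + 1), Polynomial.C (d k) * Polynomial.X ^ k
  have hpos : ∀ᶠ u : ℝ in 𝓝 0, 0 < 1 + u :=
    (by fun_prop : Continuous fun u : ℝ => 1 + u).continuousAt.eventually
      (lt_mem_nhds (by norm_num))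
  have hw : Tendsto (fun u : ℝ => u / (1 + u)) (𝓝 0) (𝓝 0) := by
    have : ContinuousAt (fun u : ℝ => u / (1 + u)) 0 :=
      ContinuousAt.div (by fun_prop) (by fun_prop) (by norm_num)
    simpa [ContinuousAt] using this
  have ha0 : ∀ v : E, a + (0 : ℝ) • v ∈ U := by simpa using ha
  have hp : (fun u : ℝ => g (a + u • (a + h)) - p.eval u) =o[𝓝 0] fun u => u ^ m := by
    have hcomp := (isBigO_refl (fun u : ℝ => (1 + u) ^ m) (𝓝 0)).mul_isLittleO
      ((hg.taylor_add_smul_isLittleO hU ha h).comp_tendsto hw)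
    refine hcomp.congr' ?_ ?_
    · filter_upwards [hpos, eventually_add_smul_mem hU (ha0 (a + h)),
        hw.eventually (eventually_add_smul_mem hU (ha0 h))] with u hu hmem hmem'
      have hne := hu.ne'
      have hscale : a + u • (a + h) = (1 + u) • (a + (u / (1 + u)) • h) := by
        rw [smul_add (1 + u), smul_smul, mul_div_cancel₀ _ hne]
        module
      rw [hscale] at hmem ⊢
      rw [hhom _ hmem' _ hu hmem, Function.comp_apply, mul_sub, Finset.mul_sum,
        Polynomial.eval_finsetSum]
      congr 1
      refine Finset.sum_congr rfl fun k hk => ?_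
      have hk : k ≤ m := by simpa [Nat.lt_succ_iff] using hk
      have hsplit : (1 + u) ^ m = (1 + u) ^ (m - k) * (1 + u) ^ k := by
        rw [← pow_add, Nat.sub_add_cancel hk]
      simp only [Polynomial.eval_mul, Polynomial.eval_C, Polynomial.eval_pow, Polynomial.eval_X,
        Polynomial.eval_add, Polynomial.eval_one]
      rw [hsplit, div_pow]
      simp only [hc]
      field_simp
    · filter_upwards [hpos] with u hu
      have hne := hu.ne'
      simp only [Function.comp_apply, div_pow]
      field_simp
  have hq : (fun u : ℝ => g (a + u • (a + h)) - q.eval u) =o[𝓝 0] fun u => u ^ m := by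
    refine (hg.taylor_add_smul_isLittleO hU ha (a + h)).congr_left fun u => ?_
    simp [q, hd, Polynomial.eval_finsetSum]
  have hdeg : (q - p).natDegree ≤ m := by
    refine (Polynomial.natDegree_sub_le _ _).trans (max_le ?_ ?_) <;>
      refine Polynomial.natDegree_sum_le_of_forall_le _ _ fun k hk => ?_
    · have hk : k ≤ m := by simpa [Nat.lt_succ_iff] using hk
      exact (Polynomial.natDegree_C_mul_X_pow_le _ _).trans hk
    · have hk : k ≤ m := by simpa [Nat.lt_succ_iff] using hk
      refine (Polynomial.natDegree_C_mul_le _ _).trans ?_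
      compute_degree
      omega
  have hqp : q - p = 0 := by
    refine Polynomial.eq_zero_of_isLittleO_pow hdeg
      (((hp.sub hq).congr_left fun u => ?_).mono nhdsWithin_le_nhds)
    rw [Polynomial.eval_sub]
    ring
  have hcoeff := congrArg (fun r : Polynomial ℝ => r.coeff m) (sub_eq_zero.1 hqp)
  simp only [p, q, Polynomial.finsetSum_coeff, Polynomial.coeff_C_mul] at hcoeff
  have hq_coeff : ∑ k ∈ Finset.range (m + 1), d k * (Polynomial.X ^ k : Polynomial ℝ).coeff m
      = d m := by
    rw [Finset.sum_eq_single m]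
    · simp
    · intro k _ hk
      simp [Polynomial.coeff_X_pow, hk.symm]
    · simp
  rw [hq_coeff] at hcoeff
  refine Eq.trans ?_ hcoeff.symm
  refine Finset.sum_congr rfl fun k hk => ?_
  have hk : k ≤ m := by simpa [Nat.lt_succ_iff] using hk
  rw [Polynomial.coeff_X_pow_mul', if_pos hk, Polynomial.coeff_one_add_X_pow]
  simp

end Line


/-- If `f` is positively homogeneous of degree `1` and `C^ℓ` on an open set
`U ⊆ ℝⁿ`, and the segment from `a` to `b` lies in `U`, then for every
`1 ≤ m ≤ ℓ` the `m`-th order Taylor polynomial of `f^m` at `a` with increment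
`b - a` equals `(1/m!) dᵐ(f^m)(a; b)`. -/
theorem taylor_pow_of_posHomogeneous_one
    (n ℓ : ℕ) (U : Set (EuclideanSpace ℝ (Fin n)))
    (hU : IsOpen U)
    (f : EuclideanSpace ℝ (Fin n) → ℝ)
    (hhom : ∀ x ∈ U, ∀ l : ℝ, 0 < l → l • x ∈ U → f (l • x) = l * f x)
    (hf : ContDiffOn ℝ ℓ f U)
    (a b : EuclideanSpace ℝ (Fin n)) (ha : a ∈ U) (hb : b ∈ U)
    (hseg : segment ℝ a b ⊆ U)
    (m : ℕ) (hm1 : 1 ≤ m) (hmℓ : m ≤ ℓ) :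
    (f a) ^ m + ∑ k ∈ Finset.Icc 1 m,
        ((k.factorial : ℝ))⁻¹ *
          iteratedFDerivWithin ℝ k (fun x => (f x) ^ m) U a (fun _ => b - a)
      = ((m.factorial : ℝ))⁻¹ *
          iteratedFDerivWithin ℝ m (fun x => (f x) ^ m) U a (fun _ => b) := by
  have hg : ContDiffOn ℝ m (fun x => (f x) ^ m) U := (hf.of_le (by exact_mod_cast hmℓ)).pow m
  have hghom : ∀ x ∈ U, ∀ l : ℝ, 0 < l → l • x ∈ U → (f (l • x)) ^ m = l ^ m * (f x) ^ m :=
    fun x hx l hl hlx => by rw [hhom x hx l hl hlx, mul_pow]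
  have key := hg.sum_iteratedFDeriv_of_posHomogeneous hU hghom ha (b - a)
  rw [add_sub_cancel, Finset.range_eq_Ico, Finset.sum_eq_sum_Ico_succ_bot (Nat.succ_pos m)] at key
  simp only [iteratedFDerivWithin_of_isOpen _ hU ha]
  simpa [Finset.Ico_add_one_right_eq_Icc] using key
end

section
/- Let U ⊆ ℝⁿ be open and let f : U → ℝ be positive homogeneous of degree m (i.e. f(λx) = λ^m f(x) for all x ∈ U and λ > 0 with λx ∈ U) and m-times continuously differentiable on U. Then for every a ∈ U, every 0 ≤ k ≤ m, and all indices μ₁, …, μ_k ∈ {1,…,n}, the k-th partial derivative of f at a can be recovered from the m-th derivative by contracting the last m − k slots with a: D_{μ₁…μ_k} f(a) = (1/(m−k)!) · Σ_{μ_{k+1},…,μ_m} D_{μ₁…μ_m} f(a) · a^{μ_{k+1}} ⋯ a^{μ_m}. Equivalently, the m-th iterated Fréchet derivative of f at a applied to (v₁, …, v_k, a, …, a) (with m − k copies of a) equals (m−k)! times the k-th iterated Fréchet derivative of f at a applied to (v₁, …, v_k), for all v₁, …, v_k ∈ ℝⁿ. -/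
section PosHomogeneous

variable {E F : Type*} [NormedAddCommGroup E] [NormedSpace ℝ E]
  [NormedAddCommGroup F] [NormedSpace ℝ F]

/-- `f` is positively homogeneous of degree `d` on `U`. -/
def PosHomogeneousOn (f : E → F) (d : ℕ) (U : Set E) : Prop :=
  ∀ x ∈ U, ∀ l : ℝ, 0 < l → l • x ∈ U → f (l • x) = l ^ d • f x

/-- Euler's identity. -/
theorem PosHomogeneousOn.fderivWithin_apply_self {f : E → F} {d : ℕ} {U : Set E}
    (h : PosHomogeneousOn f d U) (hU : IsOpen U) (hf : DifferentiableOn ℝ f U) {a : E}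
    (ha : a ∈ U) : fderivWithin ℝ f U a a = (d : ℝ) • f a := by
  rw [fderivWithin_of_isOpen hU ha]
  have hfa : HasFDerivAt f (fderiv ℝ f a) ((1 : ℝ) • a) := by
    rw [one_smul]
    exact ((hf a ha).differentiableAt (hU.mem_nhds ha)).hasFDerivAt
  have hray : HasDerivAt (fun l : ℝ => l • a) a 1 := by
    simpa using (hasDerivAt_id (1 : ℝ)).smul_const a
  have hleft : HasDerivAt (fun l : ℝ => f (l • a)) (fderiv ℝ f a a) 1 :=
    hfa.comp_hasDerivAt 1 hray
  have hright : HasDerivAt (fun l : ℝ => l ^ d • f a) ((d : ℝ) • f a) 1 := by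
    simpa using (hasDerivAt_pow d (1 : ℝ)).smul_const (f a)
  refine hleft.unique (hright.congr_of_eventuallyEq ?_)
  have hmem : ∀ᶠ l : ℝ in nhds 1, l • a ∈ U :=
    hray.continuousAt.eventually_mem (hU.mem_nhds (by simpa using ha))
  filter_upwards [hmem, eventually_gt_nhds zero_lt_one] with l hl hpos
  exact h a ha l hpos hl

theorem PosHomogeneousOn.fderivWithin {f : E → F} {d : ℕ} {U : Set E}
    (h : PosHomogeneousOn f (d + 1) U) (hU : IsOpen U) (hf : DifferentiableOn ℝ f U) :
    PosHomogeneousOn (fderivWithin ℝ f U) d U := by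
  intro x hx l hl hlx
  rw [fderivWithin_of_isOpen hU hx, fderivWithin_of_isOpen hU hlx]
  have hscale : (fun y => f (l • y)) =ᶠ[nhds x] fun y => l ^ (d + 1) • f y := by
    have hmem : ∀ᶠ y in nhds x, l • y ∈ U :=
      (continuous_const_smul l).continuousAt.eventually_mem (hU.mem_nhds hlx)
    filter_upwards [hmem, hU.mem_nhds hx] with y hly hy
    exact h y hy l hl hly
  have hderiv := hscale.fderiv_eq (𝕜 := ℝ)
  rw [fderiv_comp_smul, fderiv_fun_const_smul ((hf x hx).differentiableAt (hU.mem_nhds hx)),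
    pow_succ', mul_smul] at hderiv
  exact smul_right_injective _ hl.ne' hderiv

end PosHomogeneous

theorem iteratedFDerivWithin_succ_snoc {E F : Type*} [NormedAddCommGroup E]
    [NormedSpace ℝ E] [NormedAddCommGroup F] [NormedSpace ℝ F] {f : E → F} {U : Set E} {k : ℕ}
    (hU : UniqueDiffOn ℝ U) {a : E} (ha : a ∈ U) (v : Fin k → E) (w : E) :
    iteratedFDerivWithin ℝ (k + 1) f U a (Fin.snoc v w) =
      iteratedFDerivWithin ℝ k (fderivWithin ℝ f U) U a v w := by
  rw [iteratedFDerivWithin_succ_apply_right hU ha, Fin.init_snoc, Fin.snoc_last]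

theorem iteratedFDerivWithin_flip_apply {E F G H : Type*}
    [NormedAddCommGroup E] [NormedSpace ℝ E] [NormedAddCommGroup F] [NormedSpace ℝ F]
    [NormedAddCommGroup G] [NormedSpace ℝ G] [NormedAddCommGroup H] [NormedSpace ℝ H]
    {g : E → F →L[ℝ] G →L[ℝ] H} {U : Set E} {k : ℕ}
    (hU : UniqueDiffOn ℝ U) {a : E} (ha : a ∈ U) (v : Fin k → E) (x : G) (y : F) :
    iteratedFDerivWithin ℝ k (fun z => (g z).flip) U a v x y =
      iteratedFDerivWithin ℝ k g U a v y x := by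
  have h := ContinuousLinearEquiv.iteratedFDerivWithin_comp_left
    (F := F →L[ℝ] G →L[ℝ] H) (G := G →L[ℝ] F →L[ℝ] H)
    (ContinuousLinearMap.flipₗᵢ ℝ F G H).toContinuousLinearEquiv g hU ha k
  have hv := DFunLike.congr_fun h v
  exact DFunLike.congr_fun (DFunLike.congr_fun hv x) y

/-- The last two arguments of an iterated derivative can be exchanged. -/
theorem iteratedFDerivWithin_snoc_snoc_comm {E F : Type*} [NormedAddCommGroup E]
    [NormedSpace ℝ E] [NormedAddCommGroup F] [NormedSpace ℝ F] {f : E → F} {U : Set E} {k : ℕ}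
    (hU : IsOpen U) (hf : ContDiffOn ℝ 2 f U) {a : E} (ha : a ∈ U) (v : Fin k → E) (u w : E) :
    iteratedFDerivWithin ℝ (k + 2) f U a (Fin.snoc (Fin.snoc v u : Fin (k + 1) → E) w) =
      iteratedFDerivWithin ℝ (k + 2) f U a (Fin.snoc (Fin.snoc v w : Fin (k + 1) → E) u) := by
  have hflip : Set.EqOn (fderivWithin ℝ (fderivWithin ℝ f U) U)
      (fun y => (fderivWithin ℝ (fderivWithin ℝ f U) U y).flip) U := by
    intro y hy
    ext p q
    exact ((hf y hy).isSymmSndFDerivWithinAt (by simp) hU.uniqueDiffOn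
      (by simpa [hU.interior_eq] using subset_closure hy) hy).eq p q
  simp only [iteratedFDerivWithin_succ_snoc hU.uniqueDiffOn ha]
  rw [← iteratedFDerivWithin_flip_apply hU.uniqueDiffOn ha,
    ← iteratedFDerivWithin_congr hflip ha]

universe u

/-- Euler's identity for iterated derivatives. -/
theorem PosHomogeneousOn.iteratedFDerivWithin_snoc_self {E : Type u} [NormedAddCommGroup E]
    [NormedSpace ℝ E] {U : Set E} (hU : IsOpen U) {a : E} (ha : a ∈ U) (k : ℕ) :
    ∀ {F : Type u} [NormedAddCommGroup F] [NormedSpace ℝ F] {f : E → F} {d : ℕ},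
      PosHomogeneousOn f d U → ContDiffOn ℝ (k + 1 : ℕ) f U → k ≤ d → ∀ v : Fin k → E,
      iteratedFDerivWithin ℝ (k + 1) f U a (Fin.snoc v a) =
        ((d - k : ℕ) : ℝ) • iteratedFDerivWithin ℝ k f U a v := by
  induction k with
  | zero =>
    intro F _ _ f d h hf _ v
    rw [iteratedFDerivWithin_succ_apply_right hU.uniqueDiffOn ha, Fin.snoc_last]
    simpa using h.fderivWithin_apply_self hU (hf.differentiableOn (by simp)) ha
  | succ k ih =>
    intro F _ _ f d h hf hk v
    obtain ⟨d, rfl⟩ : ∃ e, d = e + 1 := ⟨d - 1, by omega⟩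
    have hf' : ContDiffOn ℝ (k + 1 : ℕ) (_root_.fderivWithin ℝ f U) U :=
      hf.fderivWithin hU.uniqueDiffOn (by norm_cast)
    have hih := ih (h.fderivWithin hU (hf.differentiableOn (by simp))) hf' (by omega)
      (Fin.init v)
    rw [← Fin.snoc_init_self v, iteratedFDerivWithin_snoc_snoc_comm hU
      (hf.of_le (by norm_cast; omega)) ha,
      iteratedFDerivWithin_succ_snoc hU.uniqueDiffOn ha (Fin.snoc (Fin.init v) a),
      iteratedFDerivWithin_succ_snoc (f := f) hU.uniqueDiffOn ha (Fin.init v), hih,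
      Nat.add_sub_add_right]
    rfl

theorem Fin.append_const_succ {α : Type*} {k : ℕ} (v : Fin k → α) (j : ℕ) (a : α) :
    Fin.append v (fun _ : Fin (j + 1) => a) = Fin.snoc (Fin.append v fun _ : Fin j => a) a := by
  rw [← Fin.append_snoc]
  congr 1
  ext i
  refine Fin.lastCases ?_ (fun i => ?_) i <;> simp

theorem PosHomogeneousOn.iteratedFDerivWithin_append_const {E F : Type u}
    [NormedAddCommGroup E] [NormedSpace ℝ E] [NormedAddCommGroup F] [NormedSpace ℝ F]
    {f : E → F} {d : ℕ} {U : Set E} (h : PosHomogeneousOn f d U) (hU : IsOpen U)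
    (hf : ContDiffOn ℝ d f U) {a : E} (ha : a ∈ U) {k : ℕ} (v : Fin k → E) (j : ℕ)
    (hkj : k + j ≤ d) :
    iteratedFDerivWithin ℝ (k + j) f U a (Fin.append v fun _ : Fin j => a) =
      ((d - k).descFactorial j : ℝ) • iteratedFDerivWithin ℝ k f U a v := by
  induction j with
  | zero =>
    simp only [Nat.descFactorial_zero, Nat.cast_one, one_smul]
    congr 1
    exact Fin.append_right_nil v _ rfl
  | succ j ih =>
    have hstep := h.iteratedFDerivWithin_snoc_self hU ha (k + j)
      (hf.of_le (by norm_cast)) (by omega) (Fin.append v fun _ : Fin j => a)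
    rw [Fin.append_const_succ, Nat.descFactorial_succ, Nat.cast_mul, mul_smul,
      ← ih (by omega), Nat.sub_sub]
    exact hstep

/-- If `f` is positively homogeneous of degree `m` and `C^m` on an open set
`U ⊆ ℝⁿ`, then for every `k ≤ m`, the `k`-th iterated derivative of `f` at
`a ∈ U` is recovered from the `m`-th one by contracting the last `m - k` slots
with `a` and dividing by `(m - k)!`. -/
theorem iteratedFDeriv_eq_contract_top_of_posHomogeneous
    (n m : ℕ) (U : Set (EuclideanSpace ℝ (Fin n)))
    (hU : IsOpen U)
    (f : EuclideanSpace ℝ (Fin n) → ℝ)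
    (hhom : ∀ x ∈ U, ∀ l : ℝ, 0 < l → l • x ∈ U → f (l • x) = l ^ m * f x)
    (hf : ContDiffOn ℝ m f U) :
    ∀ a ∈ U, ∀ k : ℕ, k ≤ m → ∀ v : Fin k → EuclideanSpace ℝ (Fin n),
      iteratedFDerivWithin ℝ (k + (m - k)) f U a
          (Fin.append v (fun _ : Fin (m - k) => a))
        = (((m - k).factorial : ℝ)) * iteratedFDerivWithin ℝ k f U a v := by
  intro a ha k hk v
  have h : PosHomogeneousOn f m U := hhom
  simpa [Nat.descFactorial_self] using
    h.iteratedFDerivWithin_append_const hU hf ha v (m - k) (by omega)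
end
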